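/- arXiv:2509.23005 — 3 statements merged into one kernel-verified Lean document; each statement's English description precedes it below -/
import Mathlib

section
/- Let k ≥ 1 be an integer. Let λ₁, λ₂ : ℝ² → ℝ be nonconstant affine functions whose zero sets ℓ₁ = {x ∈ ℝ² : λ₁(x) = 0} and ℓ₂ = {x ∈ ℝ² : λ₂(x) = 0} are distinct lines. Let E ⊂ ℝ² be a nonempty bounded open set such that λ₁(x)·λ₂(x) ≥ 0 for all x ∈ E. Let p be a real polynomial in two variables of total degree at most k. If (i) p vanishes at k+1 distinct points of ℓ₁ and at k+1 distinct points of ℓ₂, and (ii) ∫_E p(x) q(x) dx = 0 for every real polynomial q in two variables of total degree at most k−2, then p is the zero polynomial. -/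
open MeasureTheory

namespace MvPolynomial

/-- The polynomial of the affine function `x ↦ ∑ i, a i * x i + c` on the plane. -/
noncomputable def planarAffine (a : Fin 2 → ℝ) (c : ℝ) : MvPolynomial (Fin 2) ℝ :=
  ∑ i, C (a i) * X i + C c

@[simp]
lemma eval_planarAffine (a : Fin 2 → ℝ) (c : ℝ) (x : Fin 2 → ℝ) :
    eval x (planarAffine a c) = (∑ i, a i * x i) + c := by
  simp [planarAffine]

lemma totalDegree_planarAffine {a : Fin 2 → ℝ} (ha : a ≠ 0) (c : ℝ) :
    (planarAffine a c).totalDegree = 1 := by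
  apply le_antisymm
  · refine (totalDegree_add _ _).trans (max_le ?_ (by simp))
    refine totalDegree_finsetSum_le fun i _ => ?_
    refine (totalDegree_mul _ _).trans ?_
    simp
  · obtain ⟨i, hi⟩ := Function.ne_iff.mp ha
    have hmem : Finsupp.single i 1 ∈ (planarAffine a c).support := by
      rw [mem_support_iff]
      have : coeff (Finsupp.single i 1) (planarAffine a c) = a i := by
        have h0 (j : Fin 2) : (0 : Fin 2 →₀ ℕ) ≠ Finsupp.single j 1 :=
          (Finsupp.single_ne_zero.mpr one_ne_zero).symm
        fin_cases i <;>
          simp [planarAffine, coeff_X, coeff_C, Finsupp.single_eq_single_iff, h0]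
      rw [this]
      exact hi
    simpa using le_totalDegree hmem

lemma planarAffine_ne_zero {a : Fin 2 → ℝ} (ha : a ≠ 0) (c : ℝ) : planarAffine a c ≠ 0 := by
  intro h
  simpa [h] using totalDegree_planarAffine ha c

/-- A polynomial of total degree less than the number of its prescribed zeros on a line is
divisible by the equation of that line. -/
lemma planarAffine_dvd_of_eval_eq_zero {a : Fin 2 → ℝ} (ha : a ≠ 0) {c : ℝ}
    {p : MvPolynomial (Fin 2) ℝ} {S : Finset (Fin 2 → ℝ)} (hdeg : p.totalDegree < S.card)
    (hline : ∀ x ∈ S, (∑ i, a i * x i) + c = 0) (hzero : ∀ x ∈ S, eval x p = 0) :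
    planarAffine a c ∣ p := by
  obtain ⟨i, hi⟩ := Function.ne_iff.mp ha
  replace hi : a i ≠ 0 := hi
  obtain ⟨j, hji, hsum⟩ : ∃ j, j ≠ i ∧ ∀ {R : Type} [AddCommMonoid R] (f : Fin 2 → R),
      ∑ l, f l = f i + f j := by
    fin_cases i
    · exact ⟨1, by decide, fun f => Fin.sum_univ_two f⟩
    · exact ⟨0, by decide, fun f => (Fin.sum_univ_two f).trans (add_comm _ _)⟩
  have hcov : ∀ l, l = i ∨ l = j := by lia
  -- Substitute the solution of the line equation for the `i`-th coordinate.
  let sub : Fin 2 → Polynomial ℝ := fun l =>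
    if l = i then Polynomial.C (-a j / a i) * Polynomial.X + Polynomial.C (-c / a i)
    else Polynomial.X
  have hsolve : ∀ x ∈ S, x i = -a j / a i * x j + -c / a i := by
    intro x hx
    have h := hline x hx
    rw [hsum] at h
    field_simp
    linarith
  have hg : aeval sub p = 0 := by
    classical
    refine Polynomial.eq_zero_of_natDegree_lt_card_of_eval_eq_zero' _ (S.image fun x => x j) ?_ ?_
    · simp only [Finset.mem_image, forall_exists_index, and_imp]
      rintro _ x hx rfl
      have hcomp : (Polynomial.aeval (x j)).comp (aeval sub) = aeval x := by
        ext l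
        rcases hcov l with rfl | rfl
        · simp [sub, hsolve x hx]
        · simp [sub, hji]
      rw [← hzero x hx, ← Polynomial.coe_aeval_eq_eval, ← AlgHom.comp_apply, hcomp,
        aeval_eq_eval]
    · rw [Finset.card_image_of_injOn]
      · refine lt_of_le_of_lt (aeval_natDegree_le p le_rfl sub (n := 1) fun l => ?_) (by simpa)
        by_cases h : l = i
        · simp only [sub, h, if_true]
          exact Polynomial.natDegree_linear_le
        · simp [sub, h]
      · intro x hx y hy hxy
        funext l
        rcases hcov l with rfl | rfl
        · simp only at hxy
          rw [hsolve x hx, hsolve y hy, hxy]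
        · exact hxy
  rw [← Ideal.mem_span_singleton, ← Ideal.Quotient.eq_zero_iff_mem]
  set I := Ideal.span {planarAffine a c}
  have hcomp : (Ideal.Quotient.mkₐ ℝ I) =
      ((Ideal.Quotient.mkₐ ℝ I).comp (Polynomial.aeval (X j))).comp (aeval sub) := by
    ext l
    rcases hcov l with rfl | rfl
    · simp only [sub, AlgHom.comp_apply, aeval_X, if_true, Ideal.Quotient.mkₐ_eq_mk]
      rw [Ideal.Quotient.eq, Ideal.mem_span_singleton]
      refine ⟨C (a l)⁻¹, ?_⟩
      simp only [planarAffine, hsum, map_add, map_mul, Polynomial.aeval_C, Polynomial.aeval_X,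
        algebraMap_eq, div_eq_mul_inv, map_neg]
      have h : C (a l) * C (a l)⁻¹ = (1 : MvPolynomial (Fin 2) ℝ) := by
        rw [← map_mul, mul_inv_cancel₀ hi, map_one]
      linear_combination (-X l) * h
    · simp [sub, hji]
  have := congrArg (fun f => f p) hcomp
  simpa [hg] using this

/-- A polynomial vanishing on a nonempty open set is zero. -/
lemma eq_zero_of_eval_eq_zero_on_isOpen {σ : Type*} [Fintype σ] {p : MvPolynomial σ ℝ}
    {U : Set (σ → ℝ)} (hU : IsOpen U) (hne : U.Nonempty) (h : ∀ x ∈ U, eval x p = 0) :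
    p = 0 := by
  obtain ⟨x, hx⟩ := hne
  obtain ⟨ε, hε, hball⟩ := Metric.isOpen_iff.mp hU x hx
  refine funext_set (fun i => Metric.ball (x i) ε) (fun i => ?_) fun y hy => ?_
  · rw [Real.ball_eq_Ioo]
    exact Set.Ioo_infinite (by linarith)
  · rw [map_zero]
    exact h y (hball (by rwa [ball_pi x hε]))

/-- If the weight `w` is nonnegative on a nonempty bounded open set and `w * r ^ 2` has zero
integral there, then `w * r ^ 2` is the zero polynomial. -/
lemma eq_zero_of_setIntegral_mul_sq_eq_zero {σ : Type*} [Fintype σ] {w r : MvPolynomial σ ℝ}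
    {U : Set (σ → ℝ)} (hU : IsOpen U) (hne : U.Nonempty) (hbdd : Bornology.IsBounded U)
    (hw : ∀ x ∈ U, 0 ≤ eval x w) (hint : ∫ x in U, eval x (w * r ^ 2) = 0) :
    w * r ^ 2 = 0 := by
  have hcont := continuous_eval (w * r ^ 2)
  refine eq_zero_of_eval_eq_zero_on_isOpen hU hne ?_
  have hi : IntegrableOn (fun x => eval x (w * r ^ 2)) U :=
    (hcont.continuousOn.integrableOn_compact hbdd.isCompact_closure).mono_set subset_closure
  rw [setIntegral_eq_zero_iff_of_nonneg_ae
    (ae_restrict_of_forall_mem hU.measurableSet fun x hx => ?_) hi] at hint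
  · exact Measure.eqOn_open_of_ae_eq hint hU hcont.continuousOn continuousOn_const
  · have := hw x hx
    simp only [Pi.zero_apply, map_mul, map_pow]
    positivity

end MvPolynomial

open MvPolynomial in
/-- Unisolvence lemma for a triangle-like virtual element (2D): a polynomial of total
degree ≤ k that vanishes at k+1 distinct points of each of two distinct lines, on an
element where the product of the two affine edge equations does not change sign, and
whose internal moments against all polynomials of degree ≤ k−2 vanish, is zero. -/
theorem triangle_like_unisolvence
    (k : ℕ) (hk : 1 ≤ k)
    (a₁ a₂ : Fin 2 → ℝ) (c₁ c₂ : ℝ) (ha₁ : a₁ ≠ 0) (ha₂ : a₂ ≠ 0)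
    (hlines : {x : Fin 2 → ℝ | (∑ i, a₁ i * x i) + c₁ = 0} ≠
              {x : Fin 2 → ℝ | (∑ i, a₂ i * x i) + c₂ = 0})
    (E : Set (Fin 2 → ℝ)) (hEopen : IsOpen E) (hEne : E.Nonempty)
    (hEbdd : Bornology.IsBounded E)
    (hsign : ∀ x ∈ E, 0 ≤ ((∑ i, a₁ i * x i) + c₁) * ((∑ i, a₂ i * x i) + c₂))
    (p : MvPolynomial (Fin 2) ℝ) (hp : p.totalDegree ≤ k)
    (S₁ S₂ : Finset (Fin 2 → ℝ))
    (hS₁card : S₁.card = k + 1) (hS₂card : S₂.card = k + 1)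
    (hS₁line : ∀ x ∈ S₁, (∑ i, a₁ i * x i) + c₁ = 0)
    (hS₂line : ∀ x ∈ S₂, (∑ i, a₂ i * x i) + c₂ = 0)
    (hS₁zero : ∀ x ∈ S₁, MvPolynomial.eval x p = 0)
    (hS₂zero : ∀ x ∈ S₂, MvPolynomial.eval x p = 0)
    (hmom : ∀ q : MvPolynomial (Fin 2) ℝ, (q.totalDegree : ℤ) ≤ (k : ℤ) - 2 →
      ∫ x in E, MvPolynomial.eval x p * MvPolynomial.eval x q = 0) :
    p = 0 := by
  classical
  have hsub : ∀ {a b : Fin 2 → ℝ} {c d : ℝ}, planarAffine a c ∣ planarAffine b d →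
      {x : Fin 2 → ℝ | (∑ i, a i * x i) + c = 0} ⊆ {x | (∑ i, b i * x i) + d = 0} := by
    rintro a b c d ⟨q, hq⟩ x hx
    have := congrArg (eval x) hq
    rwa [map_mul, eval_planarAffine, eval_planarAffine, hx.out, zero_mul] at this
  have hinter : (S₂.filter fun x => (∑ i, a₁ i * x i) + c₁ = 0).card ≤ 1 := by
    by_contra! hT
    refine hlines (Set.Subset.antisymm (hsub ?_) (hsub ?_))
    · refine planarAffine_dvd_of_eval_eq_zero ha₁ ((totalDegree_planarAffine ha₂ c₂).trans_lt hT)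
        (fun x hx => (Finset.mem_filter.mp hx).2) fun x hx => ?_
      rw [eval_planarAffine]
      exact hS₂line x (Finset.mem_filter.mp hx).1
    · refine planarAffine_dvd_of_eval_eq_zero ha₂ ((totalDegree_planarAffine ha₁ c₁).trans_lt hT)
        (fun x hx => hS₂line x (Finset.mem_filter.mp hx).1) fun x hx => ?_
      rw [eval_planarAffine]
      exact (Finset.mem_filter.mp hx).2
  have hcard := Finset.card_filter_add_card_filter_not (s := S₂)
    fun x => (∑ i, a₁ i * x i) + c₁ = 0
  by_contra hp0
  obtain ⟨q, rfl⟩ := planarAffine_dvd_of_eval_eq_zero ha₁ (by omega) hS₁line hS₁zero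
  have hq0 : q ≠ 0 := right_ne_zero_of_mul hp0
  rw [totalDegree_mul_of_isDomain (planarAffine_ne_zero ha₁ c₁) hq0,
    totalDegree_planarAffine ha₁] at hp
  obtain ⟨r, rfl⟩ := planarAffine_dvd_of_eval_eq_zero ha₂
    (S := S₂.filter fun x => ¬ (∑ i, a₁ i * x i) + c₁ = 0) (p := q) (by omega)
    (fun x hx => hS₂line x (Finset.mem_filter.mp hx).1) (fun x hx => by
      obtain ⟨hx₂, hx₁⟩ := Finset.mem_filter.mp hx
      have := hS₂zero x hx₂
      rw [map_mul, eval_planarAffine] at this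
      exact (mul_eq_zero.mp this).resolve_left hx₁)
  have hr0 : r ≠ 0 := right_ne_zero_of_mul hq0
  rw [totalDegree_mul_of_isDomain (planarAffine_ne_zero ha₂ c₂) hr0,
    totalDegree_planarAffine ha₂] at hp
  refine mul_ne_zero (mul_ne_zero (planarAffine_ne_zero ha₁ c₁) (planarAffine_ne_zero ha₂ c₂))
    (pow_ne_zero 2 hr0) (eq_zero_of_setIntegral_mul_sq_eq_zero hEopen hEne hEbdd
      (fun x hx => by simpa only [map_mul, eval_planarAffine] using hsign x hx) ?_)
  rw [← hmom r (by omega)]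
  refine integral_congr_ae (.of_forall fun x => ?_)
  simp only [map_mul, map_pow]
  ring
end

section
/- Let k ≥ 1 be an integer. Let λ₁, λ₂ : ℝ² → ℝ be nonconstant affine functions whose zero sets ℓ₁ and ℓ₂ are distinct, non-parallel lines meeting at a point z. Let E ⊂ ℝ² be a nonempty bounded open set with λ₁(x)·λ₂(x) ≥ 0 for all x ∈ E. Let S₁ ⊂ ℓ₁ and S₂ ⊂ ℓ₂ be sets of k+1 distinct points each with S₁ ∩ S₂ = {z} (so |S₁ ∪ S₂| = 2k+1), and let q₁, …, q_m be a basis of the space of real polynomials in two variables of total degree at most k−2, where m = k(k−1)/2. Then the linear map Φ from the space of real polynomials in two variables of total degree at most k to ℝ^{(k+1)(k+2)/2} defined by Φ(p) = ((p(x))_{x ∈ S₁∪S₂}, (∫_E p q₁ dx, …, ∫_E p q_m dx)) is bijective. In particular, for any prescribed values at the points of S₁ ∪ S₂ and any prescribed moments against q₁, …, q_m there exists a unique polynomial of total degree at most k attaining them. -/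
open MeasureTheory

namespace MvPolynomial

/-- The polynomial of total degree at most `1` inducing the affine function `x ↦ a ⬝ x + c`. -/
noncomputable def affine (a : Fin 2 → ℝ) (c : ℝ) : MvPolynomial (Fin 2) ℝ :=
  (∑ i, C (a i) * X i) + C c

lemma eval_affine (a : Fin 2 → ℝ) (c : ℝ) (x : Fin 2 → ℝ) :
    eval x (affine a c) = (∑ i, a i * x i) + c := by
  simp [affine]

lemma sq_add_sq_ne_zero_of_ne_zero {a : Fin 2 → ℝ} (ha : a ≠ 0) : a 0 ^ 2 + a 1 ^ 2 ≠ 0 := by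
  contrapose! ha
  ext i
  fin_cases i <;> simp <;> nlinarith [sq_nonneg (a 0), sq_nonneg (a 1)]

lemma one_le_totalDegree_affine {a : Fin 2 → ℝ} (ha : a ≠ 0) (c : ℝ) :
    1 ≤ (affine a c).totalDegree := by
  by_contra! h
  have hC := totalDegree_eq_zero_iff_eq_C.mp (Nat.lt_one_iff.mp h)
  have h₁ := congrArg (eval a) hC
  have h₀ := congrArg (eval 0) hC
  simp only [eval_affine, eval_C, Fin.sum_univ_two, Pi.zero_apply, mul_zero] at h₀ h₁
  exact sq_add_sq_ne_zero_of_ne_zero ha (by linarith)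

lemma affine_ne_zero {a : Fin 2 → ℝ} (ha : a ≠ 0) (c : ℝ) : affine a c ≠ 0 := by
  intro h
  simpa [h] using one_le_totalDegree_affine ha c

lemma totalDegree_add_one_le_of_affine_mul {a : Fin 2 → ℝ} (ha : a ≠ 0) (c : ℝ)
    {r : MvPolynomial (Fin 2) ℝ} (hr : r ≠ 0) {n : ℕ} (h : (affine a c * r).totalDegree ≤ n) :
    r.totalDegree + 1 ≤ n := by
  rw [totalDegree_mul_of_isDomain (affine_ne_zero ha c) hr] at h
  have := one_le_totalDegree_affine ha c
  lia

/-- Two substitutions congruent modulo `L` give congruent values of a polynomial. -/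
lemma dvd_aeval_sub_aeval {σ R A : Type*} [CommRing R] [CommRing A] [Algebra R A] {L : A}
    {f g : σ → A} (h : ∀ i, L ∣ f i - g i) (p : MvPolynomial σ R) :
    L ∣ aeval f p - aeval g p := by
  rw [← Ideal.mem_span_singleton, ← Ideal.Quotient.mk_eq_mk_iff_sub_mem]
  have : (Ideal.Quotient.mkₐ R (Ideal.span {L})).comp (aeval f) =
      (Ideal.Quotient.mkₐ R (Ideal.span {L})).comp (aeval g) := by
    ext i
    simpa [Ideal.Quotient.mk_eq_mk_iff_sub_mem, Ideal.mem_span_singleton] using h i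
  exact DFunLike.congr_fun this p

/-- A bivariate polynomial of total degree at most `n` vanishing at more than `n` points of a line
is divisible by the equation of the line. -/
lemma affine_dvd_of_eval_eq_zero {a : Fin 2 → ℝ} (ha : a ≠ 0) (c : ℝ)
    {p : MvPolynomial (Fin 2) ℝ} {S : Finset (Fin 2 → ℝ)} (hdeg : p.totalDegree < S.card)
    (hline : ∀ x ∈ S, (∑ i, a i * x i) + c = 0) (hp : ∀ x ∈ S, eval x p = 0) :
    affine a c ∣ p := by
  have hN := sq_add_sq_ne_zero_of_ne_zero ha
  obtain ⟨z, hz⟩ : S.Nonempty := Finset.card_pos.mp (by lia)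
  have hz' := hline z hz
  simp only [Fin.sum_univ_two] at hz'
  let N := a 0 ^ 2 + a 1 ^ 2
  let d : Fin 2 → ℝ := ![-a 1 / N, a 0 / N]
  let w : Fin 2 → Polynomial ℝ := fun i => Polynomial.C (d i) * Polynomial.X + Polynomial.C (z i)
  let t : (Fin 2 → ℝ) → ℝ := fun x => a 0 * (x 1 - z 1) - a 1 * (x 0 - z 0)
  have ht : ∀ x ∈ S, (fun i => (w i).eval (t x)) = x := by
    intro x hx
    have hx' := hline x hx
    simp only [Fin.sum_univ_two] at hx'
    ext i
    fin_cases i <;> simp [w, d, t, N] <;> field_simp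
    · linear_combination (a 0) * hz' - a 0 * hx'
    · linear_combination (a 1) * hz' - a 1 * hx'
  have htinj : Set.InjOn t S := by
    intro x hx y hy hxy
    rw [← ht x hx, ← ht y hy, hxy]
  have hzero : aeval w p = 0 := by
    refine Polynomial.eq_zero_of_natDegree_lt_card_of_eval_eq_zero' _ (S.image t) ?_ ?_
    · intro s hs
      obtain ⟨x, hx, rfl⟩ := Finset.mem_image.mp hs
      have : (Polynomial.eval (t x)) (aeval w p) = eval (fun i => (w i).eval (t x)) p := by
        rw [← Polynomial.coe_aeval_eq_eval, comp_aeval_apply]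
        rfl
      rw [this, ht x hx, hp x hx]
    · rw [Finset.card_image_of_injOn htinj]
      refine lt_of_le_of_lt ?_ hdeg
      simpa using aeval_natDegree_le (n := 1) p le_rfl w
        fun i => Polynomial.natDegree_linear_le
  let T : MvPolynomial (Fin 2) ℝ := C (a 0) * (X 1 - C (z 1)) - C (a 1) * (X 0 - C (z 0))
  have key : affine a c ∣ aeval X p - aeval (fun i => Polynomial.aeval T (w i)) p := by
    refine dvd_aeval_sub_aeval (fun i => ?_) p
    refine ⟨C (a i / N), ?_⟩
    refine funext fun x => ?_
    fin_cases i <;> simp [w, d, T, N, eval_affine, MvPolynomial.algebraMap_eq] <;> field_simp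
    · linear_combination - a 0 * hz'
    · linear_combination - a 1 * hz'
  have hcomp : aeval (fun i => Polynomial.aeval T (w i)) p = Polynomial.aeval T (aeval w p) := by
    rw [comp_aeval_apply]
  rwa [hcomp, hzero, map_zero, sub_zero, aeval_X_left_apply] at key

/-- A polynomial vanishing on a nonempty open set is zero. -/
lemma eq_zero_of_eqOn_isOpen {p : MvPolynomial (Fin 2) ℝ} {U : Set (Fin 2 → ℝ)} (hU : IsOpen U)
    (hne : U.Nonempty) (h : ∀ x ∈ U, eval x p = 0) : p = 0 := by
  obtain ⟨x, hx⟩ := hne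
  obtain ⟨ε, hε, hball⟩ := Metric.isOpen_iff.mp hU x hx
  refine funext_set (fun i => Metric.ball (x i) ε) (fun i => ?_) fun y hy => ?_
  · rw [Real.ball_eq_Ioo]
    exact Set.Ioo_infinite (by linarith)
  · rw [map_zero]
    refine h y (hball ?_)
    rwa [ball_pi _ hε]

lemma integrableOn_eval_mul_eval {E : Set (Fin 2 → ℝ)} (hE : Bornology.IsBounded E)
    (p q : MvPolynomial (Fin 2) ℝ) : IntegrableOn (fun x => eval x p * eval x q) E := by
  have hc : Continuous fun x => eval x p * eval x q :=
    (continuous_eval p).mul (continuous_eval q)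
  exact (hc.continuousOn.integrableOn_compact hE.isCompact_closure).mono_set subset_closure

/-- Evaluation at the points of `S` together with the moments over `E` against the family `q`. -/
noncomputable def evalMoments {m : ℕ} {E : Set (Fin 2 → ℝ)} (hE : Bornology.IsBounded E)
    (S : Finset (Fin 2 → ℝ)) (q : Fin m → MvPolynomial (Fin 2) ℝ) :
    MvPolynomial (Fin 2) ℝ →ₗ[ℝ] (S → ℝ) × (Fin m → ℝ) where
  toFun p := (fun x => eval (x : Fin 2 → ℝ) p, fun i => ∫ x in E, eval x p * eval x (q i))
  map_add' p r := by
    ext i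
    · simp
    · simp only [map_add, add_mul, Prod.snd_add, Pi.add_apply]
      exact integral_add (integrableOn_eval_mul_eval hE p (q i))
        (integrableOn_eval_mul_eval hE r (q i))
  map_smul' s p := by
    ext i
    · simp
    · simp only [smul_eval, mul_assoc, RingHom.id_apply, Prod.smul_snd, Pi.smul_apply, smul_eq_mul]
      exact integral_const_mul s _

/-- If the moments of `p` against `q` vanish, so do those against the span of `q`. -/
lemma integral_eval_mul_eval_eq_zero_of_mem_span {ι : Type*} {E : Set (Fin 2 → ℝ)}
    (hE : Bornology.IsBounded E) {q : ι → MvPolynomial (Fin 2) ℝ} {p s : MvPolynomial (Fin 2) ℝ}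
    (hp : ∀ i, ∫ x in E, eval x p * eval x (q i) = 0) (hs : s ∈ Submodule.span ℝ (Set.range q)) :
    ∫ x in E, eval x p * eval x s = 0 := by
  induction hs using Submodule.span_induction with
  | mem s hs =>
    obtain ⟨i, rfl⟩ := hs
    exact hp i
  | zero => simp
  | add s r _ _ hs hr =>
    simp only [map_add, mul_add]
    rw [integral_add (integrableOn_eval_mul_eval hE p s) (integrableOn_eval_mul_eval hE p r),
      hs, hr, add_zero]
  | smul b s _ hs =>
    simp only [smul_eval, mul_left_comm _ b]
    rw [integral_const_mul, hs, mul_zero]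

/-- If `g ≥ 0` on a nonempty bounded open set and `∫ g s² = 0`, then `g s² = 0`. -/
lemma mul_mul_eq_zero_of_integral_eq_zero {E : Set (Fin 2 → ℝ)} (hEopen : IsOpen E)
    (hEne : E.Nonempty) (hE : Bornology.IsBounded E) {g s : MvPolynomial (Fin 2) ℝ}
    (hg : ∀ x ∈ E, 0 ≤ eval x g) (h : ∫ x in E, eval x (g * s) * eval x s = 0) :
    g * s * s = 0 := by
  refine eq_zero_of_eqOn_isOpen hEopen hEne ?_
  have hnonneg : 0 ≤ᵐ[volume.restrict E] fun x => eval x (g * s) * eval x s := by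
    filter_upwards [ae_restrict_mem hEopen.measurableSet] with x hx
    rw [map_mul, mul_assoc]
    exact mul_nonneg (hg x hx) (mul_self_nonneg _)
  rw [setIntegral_eq_zero_iff_of_nonneg_ae hnonneg (integrableOn_eval_mul_eval hE _ _)] at h
  have := Measure.eqOn_open_of_ae_eq h hEopen
    ((continuous_eval (g * s)).mul (continuous_eval s)).continuousOn continuousOn_const
  intro x hx
  simpa using this hx

/-- Pairs of exponents of total degree at most `k`, sorted by their degree. -/
noncomputable def exponentsEquivSigma (k : ℕ) :
    {n : Fin 2 →₀ ℕ | (n.sum fun _ e => e) ≤ k} ≃ Σ d : Fin (k + 1), Fin (d + 1) where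
  toFun n := ⟨⟨n.1 0 + n.1 1, by
    have := n.2
    simp only [Set.mem_ofPred_eq, Finsupp.sum_fintype, Fin.sum_univ_two, implies_true] at this
    lia⟩, ⟨n.1 0, by simp⟩⟩
  invFun x := ⟨Finsupp.equivFunOnFinite.symm ![x.2, x.1 - x.2], by
    have h₁ := x.1.2
    have h₂ := x.2.2
    simp only [Set.mem_ofPred_eq, Finsupp.sum_fintype, Fin.sum_univ_two, implies_true]
    simp
    lia⟩
  left_inv n := by
    ext i
    fin_cases i <;> simp
  right_inv x := by
    rcases x with ⟨⟨d, hd⟩, ⟨i, hi⟩⟩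
    have : i + (d - i) = d := by simp at hi; lia
    refine Sigma.ext (by simpa using this) ?_
    rw [Fin.heq_ext_iff (by simp [this])]
    simp

lemma finrank_restrictTotalDegree_fin_two (k : ℕ) :
    Module.finrank ℝ (restrictTotalDegree (Fin 2) ℝ k) = (k + 2) * (k + 1) / 2 := by
  have b := (basisRestrictSupport ℝ {n : Fin 2 →₀ ℕ | (n.sum fun _ e => e) ≤ k}).reindex
    (exponentsEquivSigma k)
  rw [restrictTotalDegree, Module.finrank_eq_card_basis b, Fintype.card_sigma]
  simp only [Fintype.card_fin]
  rw [Fin.sum_univ_eq_sum_range (fun i => i + 1), ← add_zero (∑ i ∈ _, _),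
    ← Finset.sum_range_succ' (fun i => i), Finset.sum_range_id]
  rfl

end MvPolynomial

open MvPolynomial in
/-- A polynomial of total degree at most `k` vanishing at all nodes and with vanishing moments
against the polynomials of total degree at most `k - 2` is zero. -/
lemma eq_zero_of_eval_eq_zero_of_moments_eq_zero {k : ℕ} {a₁ a₂ : Fin 2 → ℝ} {c₁ c₂ : ℝ}
    (ha₁ : a₁ ≠ 0) (ha₂ : a₂ ≠ 0) (hnp : a₁ 0 * a₂ 1 - a₁ 1 * a₂ 0 ≠ 0)
    {z : Fin 2 → ℝ} (hz₁ : (∑ i, a₁ i * z i) + c₁ = 0) (hz₂ : (∑ i, a₂ i * z i) + c₂ = 0)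
    {E : Set (Fin 2 → ℝ)} (hEopen : IsOpen E) (hEne : E.Nonempty) (hEbdd : Bornology.IsBounded E)
    (hsign : ∀ x ∈ E, 0 ≤ ((∑ i, a₁ i * x i) + c₁) * ((∑ i, a₂ i * x i) + c₂))
    {S₁ S₂ : Finset (Fin 2 → ℝ)} (hS₁card : S₁.card = k + 1) (hS₂card : S₂.card = k + 1)
    (hS₁line : ∀ x ∈ S₁, (∑ i, a₁ i * x i) + c₁ = 0)
    (hS₂line : ∀ x ∈ S₂, (∑ i, a₂ i * x i) + c₂ = 0)
    {p : MvPolynomial (Fin 2) ℝ} (hpdeg : p.totalDegree ≤ k)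
    (hp₁ : ∀ x ∈ S₁, eval x p = 0) (hp₂ : ∀ x ∈ S₂, eval x p = 0)
    (hmom : ∀ s : MvPolynomial (Fin 2) ℝ, s.totalDegree + 2 ≤ k →
      ∫ x in E, eval x p * eval x s = 0) :
    p = 0 := by
  classical
  obtain ⟨r, rfl⟩ := affine_dvd_of_eval_eq_zero ha₁ c₁ (by lia) hS₁line hp₁
  by_cases hr : r = 0
  · simp [hr]
  have hrdeg := totalDegree_add_one_le_of_affine_mul ha₁ c₁ hr hpdeg
  have hr₂ : ∀ x ∈ S₂.erase z, eval x r = 0 := by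
    intro x hx
    obtain ⟨hxz, hx⟩ := Finset.mem_erase.mp hx
    have h := hp₂ x hx
    rw [map_mul, eval_affine] at h
    refine (mul_eq_zero.mp h).resolve_left fun h₁ => hxz ?_
    have h₂ := hS₂line x hx
    simp only [Fin.sum_univ_two] at h₁ h₂ hz₁ hz₂
    ext i
    fin_cases i <;> refine mul_left_cancel₀ hnp ?_ <;> simp only [Fin.zero_eta, Fin.mk_one]
    · linear_combination a₂ 1 * (h₁ - hz₁) - a₁ 1 * (h₂ - hz₂)
    · linear_combination a₁ 0 * (h₂ - hz₂) - a₂ 0 * (h₁ - hz₁)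
  have hcard : r.totalDegree < (S₂.erase z).card := by
    have := Finset.pred_card_le_card_erase (s := S₂) (a := z)
    lia
  obtain ⟨s, rfl⟩ := affine_dvd_of_eval_eq_zero ha₂ c₂ hcard
    (fun x hx => hS₂line x (Finset.mem_of_mem_erase hx)) hr₂
  by_cases hs : s = 0
  · simp [hs]
  have hsdeg := totalDegree_add_one_le_of_affine_mul ha₂ c₂ hs le_rfl
  have hint := hmom s (by lia)
  rw [← mul_assoc] at hint ⊢
  have := mul_mul_eq_zero_of_integral_eq_zero hEopen hEne hEbdd
    (fun x hx => by simpa only [map_mul, eval_affine] using hsign x hx) hint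
  exact (mul_eq_zero.mp this).resolve_right hs

/-- Interpolation form of the unisolvence lemma for a triangle-like virtual element:
the map sending a bivariate polynomial of total degree ≤ k to its values at the
2k+1 points of S₁ ∪ S₂ (k+1 points on each of two non-parallel lines, sharing the
common point z) together with its moments over E against a basis q₁, …, q_m
(m = k(k−1)/2) of the polynomials of total degree ≤ k−2, is bijective. -/
theorem triangle_like_interpolation
    (k : ℕ) (hk : 1 ≤ k) (m : ℕ) (hm : m = k * (k - 1) / 2)
    [DecidableEq (Fin 2 → ℝ)]
    (a₁ a₂ : Fin 2 → ℝ) (c₁ c₂ : ℝ) (ha₁ : a₁ ≠ 0) (ha₂ : a₂ ≠ 0)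
    -- the two lines are non-parallel (hence distinct)
    (hnp : a₁ 0 * a₂ 1 - a₁ 1 * a₂ 0 ≠ 0)
    (z : Fin 2 → ℝ)
    (hz₁ : (∑ i, a₁ i * z i) + c₁ = 0) (hz₂ : (∑ i, a₂ i * z i) + c₂ = 0)
    (E : Set (Fin 2 → ℝ)) (hEopen : IsOpen E) (hEne : E.Nonempty)
    (hEbdd : Bornology.IsBounded E)
    (hsign : ∀ x ∈ E, 0 ≤ ((∑ i, a₁ i * x i) + c₁) * ((∑ i, a₂ i * x i) + c₂))
    (S₁ S₂ : Finset (Fin 2 → ℝ))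
    (hS₁card : S₁.card = k + 1) (hS₂card : S₂.card = k + 1)
    (hS₁line : ∀ x ∈ S₁, (∑ i, a₁ i * x i) + c₁ = 0)
    (hS₂line : ∀ x ∈ S₂, (∑ i, a₂ i * x i) + c₂ = 0)
    (hinter : S₁ ∩ S₂ = {z})
    (q : Fin m → MvPolynomial (Fin 2) ℝ)
    -- q₁, …, q_m is a basis of the polynomials of total degree ≤ k − 2
    (hqind : LinearIndependent ℝ q)
    (hqspan : Submodule.span ℝ (Set.range q) =
      MvPolynomial.restrictSupport ℝ
        {n : Fin 2 →₀ ℕ | ((n.sum fun _ e => e : ℕ) : ℤ) ≤ (k : ℤ) - 2}) :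
    Function.Bijective
      (fun p : MvPolynomial.restrictTotalDegree (Fin 2) ℝ k =>
        ((fun x : (S₁ ∪ S₂ : Finset (Fin 2 → ℝ)) =>
            MvPolynomial.eval (x : Fin 2 → ℝ) (p : MvPolynomial (Fin 2) ℝ),
          fun i : Fin m =>
            ∫ x in E, MvPolynomial.eval x (p : MvPolynomial (Fin 2) ℝ) *
              MvPolynomial.eval x (q i)) :
          ((S₁ ∪ S₂ : Finset (Fin 2 → ℝ)) → ℝ) × (Fin m → ℝ))) := by
  have hfin : Module.finrank ℝ (MvPolynomial.restrictTotalDegree (Fin 2) ℝ k) =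
      Module.finrank ℝ (((S₁ ∪ S₂ : Finset (Fin 2 → ℝ)) → ℝ) × (Fin m → ℝ)) := by
    have hcard := Finset.card_union_add_card_inter S₁ S₂
    rw [hinter, Finset.card_singleton] at hcard
    rw [MvPolynomial.finrank_restrictTotalDegree_fin_two, Module.finrank_prod,
      Module.finrank_pi, Module.finrank_pi, Fintype.card_coe, Fintype.card_fin]
    obtain ⟨j, rfl⟩ : ∃ j, k = j + 1 := ⟨k - 1, by lia⟩
    have h : (j + 1 + 2) * (j + 1 + 1) = (j + 1) * (j + 1 - 1) + 2 * (2 * j + 3) := by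
      simp only [Nat.add_sub_cancel]
      ring
    rw [h, Nat.add_mul_div_left _ _ two_pos, hm]
    lia
  let Φ := (MvPolynomial.evalMoments hEbdd (S₁ ∪ S₂) q).domRestrict
    (MvPolynomial.restrictTotalDegree (Fin 2) ℝ k)
  have hinj : Function.Injective Φ := by
    refine (injective_iff_map_eq_zero Φ).mpr fun p hp => Subtype.ext ?_
    have heval : ∀ x ∈ S₁ ∪ S₂, MvPolynomial.eval x p.1 = 0 :=
      fun x hx => congrFun (congrArg Prod.fst hp) ⟨x, hx⟩
    have hmom : ∀ i, ∫ x in E, MvPolynomial.eval x p.1 * MvPolynomial.eval x (q i) = 0 :=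
      congrFun (congrArg Prod.snd hp)
    refine eq_zero_of_eval_eq_zero_of_moments_eq_zero ha₁ ha₂ hnp hz₁ hz₂ hEopen hEne hEbdd hsign
      hS₁card hS₂card hS₁line hS₂line ((MvPolynomial.mem_restrictTotalDegree _ _ _).mp p.2)
      (fun x hx => heval x (Finset.mem_union_left _ hx))
      (fun x hx => heval x (Finset.mem_union_right _ hx)) fun s hs => ?_
    refine MvPolynomial.integral_eval_mul_eval_eq_zero_of_mem_span hEbdd hmom ?_
    rw [hqspan, MvPolynomial.mem_restrictSupport_iff]
    intro n hn
    have := MvPolynomial.le_totalDegree hn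
    simp only [Set.mem_ofPred_eq]
    lia
  exact ⟨hinj, (LinearMap.injective_iff_surjective_of_finrank_eq_finrank hfin).mp hinj⟩
end

section
/- Let (V, ‖·‖) be a real normed vector space, T a finite index set, and for each E ∈ T let a^E and a_h^E be symmetric positive semidefinite bilinear forms on V; set a(w,v) = Σ_{E∈T} a^E(w,v), a_h(w,v) = Σ_{E∈T} a_h^E(w,v), and ‖v‖_h = (a_h(v,v))^{1/2}. Let W ⊆ V be a linear subspace (the discrete test space) and Π ⊆ V a linear subspace (the piecewise polynomials) such that the consistency property a_h^E(w, p) = a^E(w, p) holds for every E ∈ T, every w ∈ V and every p ∈ Π. Assume there exist constants c > 0, α* > 0, M > 0 such that: (i) c‖v‖² ≤ a(v,v) for all v ∈ W (coercivity); (ii) α* a(v,v) ≤ a_h(v,v) for all v ∈ W (stability); (iii) a(v,v) ≤ M‖v‖² for all v ∈ V (continuity). Let F, F_h : V → ℝ be linear functionals with |F(v) − F_h(v)| ≤ η‖v‖ for all v ∈ W, for some η ≥ 0. Suppose u ∈ V satisfies a(u, v) = F(v) for all v ∈ W, and suppose u_I, u_h ∈ V with u_h − u_I ∈ W satisfy a_h(u_h,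 v) = F_h(v) for all v ∈ W. Then there is a constant C > 0, depending only on c, α* and M, such that for every u_π ∈ Π: ‖u − u_h‖ ≤ C ( ‖u − u_I‖ + ‖u_I − u_π‖_h + ‖u − u_π‖ + η ). -/
/-- Cauchy–Schwarz inequality for a symmetric positive semidefinite bilinear form. -/
theorem abs_apply_le_sqrt_mul_sqrt {V : Type*} [AddCommGroup V] [Module ℝ V]
    (B : V →ₗ[ℝ] V →ₗ[ℝ] ℝ) (hs : ∀ w v, B w v = B v w) (hp : ∀ v, 0 ≤ B v v) (x y : V) :
    |B x y| ≤ √(B x x) * √(B y y) := by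
  rw [← Real.sqrt_mul (hp x)]
  refine Real.abs_le_sqrt ?_
  simpa [sq, hs y x] using LinearMap.BilinForm.apply_mul_apply_le_of_forall_zero_le B hp x y

/-- Strang-type estimate for the discrete error, in terms of global bilinear forms. -/
theorem norm_discrete_error_le {V : Type*} [NormedAddCommGroup V] [NormedSpace ℝ V]
    {k M η : ℝ} (hk : 0 < k) (hM : 0 ≤ M) (hη : 0 ≤ η)
    (A B : V →ₗ[ℝ] V →ₗ[ℝ] ℝ)
    (hAs : ∀ w v, A w v = A v w) (hAp : ∀ v, 0 ≤ A v v)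
    (hBs : ∀ w v, B w v = B v w) (hBp : ∀ v, 0 ≤ B v v)
    (hcont : ∀ v, A v v ≤ M * ‖v‖ ^ 2) {u uI uh p : V}
    (hcoer : k ^ 2 * ‖uh - uI‖ ^ 2 ≤ B (uh - uI) (uh - uI))
    (hcons : B p (uh - uI) = A p (uh - uI))
    (hdata : |A u (uh - uI) - B uh (uh - uI)| ≤ η * ‖uh - uI‖) :
    ‖uh - uI‖ ≤ ((η + M * ‖u - p‖) / k + √(B (uI - p) (uI - p))) / k := by
  have hid : B (uh - uI) (uh - uI) = -(A u (uh - uI) - B uh (uh - uI))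
      + A (u - p) (uh - uI) - B (uI - p) (uh - uI) := by
    have h1 : B (uh - uI) (uh - uI) = B uh (uh - uI) - B uI (uh - uI) := by
      rw [map_sub B, LinearMap.sub_apply]
    rw [h1, map_sub A u p, map_sub B uI p, LinearMap.sub_apply, LinearMap.sub_apply, hcons]
    ring
  generalize uh - uI = δ at *
  have hA : |A (u - p) δ| ≤ M * ‖u - p‖ * ‖δ‖ := by
    refine (abs_apply_le_sqrt_mul_sqrt A hAs hAp _ _).trans ?_
    have hb : ∀ v, √(A v v) ≤ √M * ‖v‖ := fun v => by
      refine (Real.sqrt_le_sqrt (hcont v)).trans_eq ?_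
      rw [Real.sqrt_mul hM, Real.sqrt_sq (norm_nonneg v)]
    calc √(A (u - p) (u - p)) * √(A δ δ) ≤ (√M * ‖u - p‖) * (√M * ‖δ‖) := by
          gcongr <;> exact hb _
      _ = (√M * √M) * ‖u - p‖ * ‖δ‖ := by ring
      _ = M * ‖u - p‖ * ‖δ‖ := by rw [Real.mul_self_sqrt hM]
  have hB := abs_apply_le_sqrt_mul_sqrt B hBs hBp (uI - p) δ
  have hkδ : k * ‖δ‖ ≤ √(B δ δ) := Real.le_sqrt_of_sq_le (by rwa [mul_pow])
  have hδ : ‖δ‖ ≤ √(B δ δ) / k := by rwa [le_div_iff₀' hk]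
  rw [← Real.mul_self_sqrt (hBp δ)] at hid
  have hnn : 0 ≤ √(B δ δ) := Real.sqrt_nonneg _
  generalize √(B δ δ) = D at *
  refine hδ.trans (div_le_div_of_nonneg_right ?_ hk.le)
  have hm : (η + M * ‖u - p‖) * ‖δ‖ ≤ (η + M * ‖u - p‖) * (D / k) := by gcongr
  have hmul : D * D ≤ ((η + M * ‖u - p‖) / k + √(B (uI - p) (uI - p))) * D := by
    have he : (η + M * ‖u - p‖) * (D / k) = (η + M * ‖u - p‖) / k * D := by ring
    linarith [neg_le_of_abs_le hdata, le_of_abs_le hA, neg_le_of_abs_le hB]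
  rcases hnn.eq_or_lt with h0 | h0
  · rw [← h0]; positivity
  · exact le_of_mul_le_mul_right hmul h0

/-- Abstract error estimate for the stabilized virtual element discretization:
given elementwise symmetric positive semidefinite bilinear forms `aE` (exact) and
`ahE` (discrete) with the polynomial consistency property, coercivity of
`a = Σ aE` on the discrete test space `W`, stability `α* a ≤ a_h` on `W`,
continuity `a(v,v) ≤ M ‖v‖²`, and data-approximation bound `|F v − F_h v| ≤ η ‖v‖`,
if `u` solves the exact problem and `u_h` the discrete one (with `u_h − u_I ∈ W`),
then `‖u − u_h‖ ≤ C (‖u − u_I‖ + ‖u_I − u_π‖_h + ‖u − u_π‖ + η)` for every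
elementwise polynomial `u_π`, with `C` depending only on `c`, `α*`, `M`. -/
theorem abstract_vem_error_estimate (c αs M : ℝ) (hc : 0 < c) (hαs : 0 < αs) (hM : 0 < M) :
    ∃ C : ℝ, 0 < C ∧
      ∀ (V : Type) [NormedAddCommGroup V] [NormedSpace ℝ V]
        (ι : Type) [Fintype ι]
        (aE ahE : ι → V →ₗ[ℝ] V →ₗ[ℝ] ℝ),
        (∀ e : ι, ∀ w v : V, aE e w v = aE e v w) →
        (∀ e : ι, ∀ v : V, 0 ≤ aE e v v) →
        (∀ e : ι, ∀ w v : V, ahE e w v = ahE e v w) →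
        (∀ e : ι, ∀ v : V, 0 ≤ ahE e v v) →
        ∀ (W P : Submodule ℝ V),
        -- polynomial consistency: a_h^E(w, p) = a^E(w, p) for p ∈ Π
        (∀ e : ι, ∀ w : V, ∀ p ∈ P, ahE e w p = aE e w p) →
        -- (i) coercivity on W
        (∀ v ∈ W, c * ‖v‖ ^ 2 ≤ ∑ e : ι, aE e v v) →
        -- (ii) stability on W
        (∀ v ∈ W, αs * (∑ e : ι, aE e v v) ≤ ∑ e : ι, ahE e v v) →
        -- (iii) continuity
        (∀ v : V, (∑ e : ι, aE e v v) ≤ M * ‖v‖ ^ 2) →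
        ∀ (F Fh : V →ₗ[ℝ] ℝ) (η : ℝ), 0 ≤ η →
        (∀ v ∈ W, |F v - Fh v| ≤ η * ‖v‖) →
        ∀ u uI uh : V,
        -- exact problem
        (∀ v ∈ W, (∑ e : ι, aE e u v) = F v) →
        uh - uI ∈ W →
        -- discrete problem
        (∀ v ∈ W, (∑ e : ι, ahE e uh v) = Fh v) →
        ∀ uπ ∈ P,
          ‖u - uh‖ ≤ C * (‖u - uI‖ +
            Real.sqrt (∑ e : ι, ahE e (uI - uπ) (uI - uπ)) + ‖u - uπ‖ + η) := by
  have hkpos : 0 < √(αs * c) := by positivity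
  have hksq : √(αs * c) ^ 2 = αs * c := Real.sq_sqrt (by positivity)
  generalize √(αs * c) = k at hkpos hksq
  refine ⟨1 + 1 / k ^ 2 + M / k ^ 2 + 1 / k, by positivity, ?_⟩
  intro V _ _ ι _ aE ahE hAs hAp hBs hBp W P hcons hcoer hstab hcont F Fh η hη hdata
    u uI uh hu hW huh p hp
  have hA : ∀ x y, (∑ e, aE e) x y = ∑ e, aE e x y := fun x y => by
    simp [LinearMap.sum_apply]
  have hB : ∀ x y, (∑ e, ahE e) x y = ∑ e, ahE e x y := fun x y => by
    simp [LinearMap.sum_apply]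
  have hδ : ‖uh - uI‖ ≤ ((η + M * ‖u - p‖) / k + √((∑ e, ahE e) (uI - p) (uI - p))) / k := by
    apply norm_discrete_error_le hkpos hM.le hη (∑ e, aE e) (∑ e, ahE e) <;>
      simp only [hA, hB]
    · exact fun w v => Finset.sum_congr rfl fun e _ => hAs e w v
    · exact fun v => Finset.sum_nonneg fun e _ => hAp e v
    · exact fun w v => Finset.sum_congr rfl fun e _ => hBs e w v
    · exact fun v => Finset.sum_nonneg fun e _ => hBp e v
    · exact hcont
    · rw [hksq, mul_assoc]
      exact (mul_le_mul_of_nonneg_left (hcoer _ hW) hαs.le).trans (hstab _ hW)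
    · exact Finset.sum_congr rfl fun e _ => by rw [hBs, hAs, hcons e _ p hp]
    · rw [hu _ hW, huh _ hW]
      exact hdata _ hW
  rw [hB] at hδ
  have htri : ‖u - uh‖ ≤ ‖u - uI‖ + ‖uh - uI‖ := by
    rw [norm_sub_rev uh uI]
    exact norm_sub_le_norm_sub_add_norm_sub u uI uh
  have hS := Real.sqrt_nonneg (∑ e, ahE e (uI - p) (uI - p))
  generalize √(∑ e, ahE e (uI - p) (uI - p)) = S at *
  have ha := norm_nonneg (u - uI)
  have ht := norm_nonneg (u - p)
  generalize ‖u - uI‖ = a at *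
  generalize ‖u - p‖ = t at *
  refine (htri.trans (add_le_add_right hδ a)).trans ?_
  have hrest : 0 ≤ (1 / k ^ 2 + M / k ^ 2 + 1 / k) * a + (1 + 1 / k ^ 2 + M / k ^ 2) * S
      + (1 + 1 / k ^ 2 + 1 / k) * t + (1 + M / k ^ 2 + 1 / k) * η := by positivity
  have he : ((η + M * t) / k + S) / k = 1 / k ^ 2 * η + M / k ^ 2 * t + 1 / k * S := by
    field_simp
  rw [he]
  linarith
end
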